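/- Fix the sample profile s'. Over the random assignment, for each buyer i independently and uniformly, of the remaining two valuation functions v_i^1, v_i^2 to r_i and s_i, for every item j ∈ [m]: E[max_{i: j∈B_i} a_j(r_i,B_i)] ≥ (1/4)·E[p_j^(n+1)], i.e., the expected largest j-bid in r is at least a quarter of the expected final price of item j in the modified buyer-wise greedy algorithm run on s. -/

import Mathlib

open scoped BigOperators

/-- A valuation is a real-valued set function on bundles of the `m` items. -/
abbrev Val (m : ℕ) := Finset (Fin m) → ℝ

/-- A (normalized, monotone) valuation. -/
def IsValuation {m : ℕ} (v : Val m) : Prop :=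
  v ∅ = 0 ∧ ∀ A B : Finset (Fin m), A ⊆ B → v A ≤ v B

/-- XOS (fractionally subadditive) valuations: a pointwise maximum of finitely many
nonnegative additive functions. -/
def IsXOS {m : ℕ} (v : Val m) : Prop :=
  ∃ (k : ℕ) (a : Fin (k + 1) → Fin m → ℝ),
    (∀ ℓ j, 0 ≤ a ℓ j) ∧ ∀ B : Finset (Fin m), v B = ⨆ ℓ, ∑ j ∈ B, a ℓ j

/-- An allocation: pairwise disjoint bundles. -/
def IsAlloc {n m : ℕ} (A : Fin n → Finset (Fin m)) : Prop :=
  ∀ i i' : Fin n, i ≠ i' → Disjoint (A i) (A i')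

/-- The optimal offline welfare of a valuation profile. -/
noncomputable def OPT {n m : ℕ} (v : Fin n → Val m) : ℝ :=
  ⨆ A : {A : Fin n → Finset (Fin m) // IsAlloc A}, ∑ i, v i (A.1 i)

/-- `B` is a demand set of valuation `v` at prices `p` among the available items `M`:
it maximizes the utility `v(B) - Σ_{j ∈ B} p j` over subsets of `M`. -/
def IsDemand {m : ℕ} (v : Val m) (p : Fin m → ℝ) (M : Finset (Fin m))
    (B : Finset (Fin m)) : Prop :=
  B ⊆ M ∧ ∀ B' ⊆ M, v B' - ∑ j ∈ B', p j ≤ v B - ∑ j ∈ B, p j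

/-- `a` is an additive supporting function of `v` on `B`. -/
def IsSupport {m : ℕ} (v : Val m) (B : Finset (Fin m)) (a : Fin m → ℝ) : Prop :=
  (∀ j, 0 ≤ a j) ∧ (∀ j, j ∉ B → a j = 0) ∧
  (∀ B' : Finset (Fin m), ∑ j ∈ B', a j ≤ v B') ∧ ∑ j ∈ B, a j = v B

/-- The least power of two that is at least `x` (by convention `0` for `x ≤ 0`). -/
noncomputable def pow2ceil (x : ℝ) : ℝ :=
  if x ≤ 0 then 0 else (2 : ℝ) ^ (⌈Real.logb 2 x⌉ : ℤ)

variable {n m : ℕ}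

/-- The sample profile `s` determined by the coin flips `c`. -/
def sOf (f1 f2 : Fin n → Val m) (c : Fin n → Bool) : Fin n → Val m :=
  fun i => if c i then f1 i else f2 i

/-- The actual profile `r` determined by the coin flips `c`. -/
def rOf (f1 f2 : Fin n → Val m) (c : Fin n → Bool) : Fin n → Val m :=
  fun i => if c i then f2 i else f1 i

section Coins

variable (d : (Fin m → ℝ) → Val m → Finset (Fin m))
  (p : (Fin n → Val m) → Fin (n + 1) → Fin m → ℝ)
  (f1 f2 : Fin n → Val m)

/-- `B i`: the demand set of the actual valuation `r_i` at the prices `p^(i)` set by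
the modified buyer-wise greedy algorithm run on the sample `s`. -/
def Bset (c : Fin n → Bool) (i : Fin n) : Finset (Fin m) :=
  d (p (sOf f1 f2 c) i.castSucc) (rOf f1 f2 c i)

end Coins

/-- The maximum of `0` and all values of a finite family of reals. -/
noncomputable def maxZero {k : ℕ} (g : Fin k → ℝ) : ℝ := Finset.univ.fold max 0 g

lemma maxZero_succ {k : ℕ} (g : Fin (k + 1) → ℝ) :
    maxZero g = max (g 0) (maxZero fun i => g i.succ) := by
  simp [maxZero, Fin.univ_succ, Finset.fold_map]

lemma maxZero_nonneg {k : ℕ} (g : Fin k → ℝ) : 0 ≤ maxZero g :=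
  (Finset.le_fold_max 0).2 (Or.inl le_rfl)

lemma le_maxZero {k : ℕ} (g : Fin k → ℝ) (i : Fin k) : g i ≤ maxZero g :=
  (Finset.le_fold_max _).2 (Or.inr ⟨i, Finset.mem_univ i, le_rfl⟩)

lemma maxZero_le {k : ℕ} {g : Fin k → ℝ} {x : ℝ} (hx : 0 ≤ x) (hg : ∀ i, g i ≤ x) :
    maxZero g ≤ x :=
  (Finset.fold_max_le _).2 ⟨hx, fun i _ => hg i⟩

lemma sum_coins_succ {k : ℕ} (F : (Fin (k + 1) → Bool) → ℝ) :
    ∑ c, F c = ∑ c : Fin k → Bool,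
      (F (Fin.cons (α := fun _ => Bool) true c) + F (Fin.cons (α := fun _ => Bool) false c)) := by
  rw [← (Fin.consEquiv fun _ : Fin (k + 1) => Bool).sum_comp F, Fintype.sum_prod_type,
    Fintype.sum_bool, ← Finset.sum_add_distrib]
  rfl

/-- In round `i`, a pair of values `b i c true`, `b i c false` determined by the coins of the earlier
rounds is revealed, and coin `c i` selects one of them. On average, the largest selected value
is at most twice the largest rejected value; the running maximum `y` strengthens the induction. -/
lemma sum_max_selected_le {k : ℕ} (b : Fin k → (Fin k → Bool) → Bool → ℝ)
    (hb : ∀ i c c', (∀ l < i, c l = c' l) → b i c = b i c') {y : ℝ} (hy : 0 ≤ y) :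
    ∑ c : Fin k → Bool, (y + max y (maxZero fun i => b i c (c i))) ≤
      ∑ c : Fin k → Bool, 2 * max y (maxZero fun i => b i c (!c i)) := by
  induction k generalizing y with
  | zero => simp [maxZero, hy, two_mul]
  | succ k ih =>
    obtain ⟨β, hβ⟩ : ∃ β : Bool → ℝ, ∀ c, b 0 c = β :=
      ⟨b 0 fun _ => true, fun c => hb 0 _ _ fun l hl => absurd hl (Fin.not_lt_zero l)⟩
    have tail (x : Bool) {z : ℝ} (hz : 0 ≤ z) :=
      ih (fun i c => b i.succ (Fin.cons (α := fun _ => Bool) x c)) (fun i c c' h => by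
        refine hb _ _ _ fun l hl => ?_
        cases l using Fin.cases with
        | zero => rfl
        | succ l => simpa using h l (Fin.succ_lt_succ_iff.1 hl)) hz
    have h := add_le_add (tail true (le_max_of_le_left (c := β false) hy))
      (tail false (le_max_of_le_left (c := β true) hy))
    rw [← Finset.sum_add_distrib, ← Finset.sum_add_distrib] at h
    rw [sum_coins_succ, sum_coins_succ]
    simp only [maxZero_succ, hβ, Fin.cons_zero, Fin.cons_succ, Bool.not_true, Bool.not_false]
    simp only [max_assoc] at h
    refine le_trans (Finset.sum_le_sum fun c _ => ?_) (h.trans_eq ?_)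
    · generalize maxZero _ = S₁
      generalize maxZero _ = S₂
      grind
    · exact Finset.sum_congr rfl fun c _ => by ring

lemma pow2ceil_le {x : ℝ} (hx : 0 ≤ x) : pow2ceil x ≤ 2 * x := by
  unfold pow2ceil
  split_ifs with h
  · positivity
  · push Not at h
    rw [← Real.rpow_intCast]
    calc (2 : ℝ) ^ ((⌈Real.logb 2 x⌉ : ℤ) : ℝ) ≤ 2 ^ (Real.logb 2 x + 1) :=
          Real.rpow_le_rpow_of_exponent_le one_le_two (Int.ceil_lt_add_one _).le
      _ = 2 * x := by
          rw [Real.rpow_add two_pos, Real.rpow_logb two_pos (by norm_num) h, Real.rpow_one,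
            mul_comm]

/-- With the sample profile `s'` fixed, each buyer's remaining two
valuation functions `f1 i, f2 i` are assigned independently and uniformly at random
(coin flips `c`) to the sample `s_i` and the actual valuation `r_i`.  The modified
buyer-wise greedy algorithm (demand sets chosen by the fixed rule `d`, supporting
functions by the fixed rule `asup`, prices rounded up to powers of two) run on `s`
produces prices `p`, and `B i` is the demand set of `r_i` at the prices `p^(i)`.
Then, for every item `j`, the expected largest `j`-bid in `r` is at least a quarter
of the expected final greedy price `p^(n+1)_j`. -/
theorem stmt8 (f1 f2 : Fin n → Val m)
    (hf1 : ∀ i, IsValuation (f1 i) ∧ IsXOS (f1 i))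
    (hf2 : ∀ i, IsValuation (f2 i) ∧ IsXOS (f2 i))
    (d : (Fin m → ℝ) → Val m → Finset (Fin m))
    (hd : ∀ q v, IsDemand v q Finset.univ (d q v))
    (asup : Val m → Finset (Fin m) → Fin m → ℝ)
    (hsup1 : ∀ i B, IsSupport (f1 i) B (asup (f1 i) B))
    (hsup2 : ∀ i B, IsSupport (f2 i) B (asup (f2 i) B))
    (p : (Fin n → Val m) → Fin (n + 1) → Fin m → ℝ)
    (hp0 : ∀ c j, p (sOf f1 f2 c) 0 j = 0)
    (hupd : ∀ (c : Fin n → Bool) (i : Fin n) (j : Fin m),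
      p (sOf f1 f2 c) i.succ j =
        if j ∈ d (p (sOf f1 f2 c) i.castSucc) (sOf f1 f2 c i)
        then pow2ceil
          (asup (sOf f1 f2 c i) (d (p (sOf f1 f2 c) i.castSucc) (sOf f1 f2 c i)) j)
        else p (sOf f1 f2 c) i.castSucc j)
    (j : Fin m) :
    (Fintype.card (Fin n → Bool) : ℝ)⁻¹ *
        ∑ c : Fin n → Bool,
          (⨆ i : {i : Fin n // j ∈ Bset d p f1 f2 c i},
            asup (rOf f1 f2 c i.1) (Bset d p f1 f2 c i.1) j) ≥
      (1 / 4) *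
        ((Fintype.card (Fin n → Bool) : ℝ)⁻¹ *
          ∑ c : Fin n → Bool, p (sOf f1 f2 c) (Fin.last n) j) := by
  have sup_s (c : Fin n → Bool) (i : Fin n) (B : Finset (Fin m)) :
      IsSupport (sOf f1 f2 c i) B (asup (sOf f1 f2 c i) B) := by
    unfold sOf; split_ifs
    exacts [hsup1 i B, hsup2 i B]
  have sup_r (c : Fin n → Bool) (i : Fin n) (B : Finset (Fin m)) :
      IsSupport (rOf f1 f2 c i) B (asup (rOf f1 f2 c i) B) := by
    unfold rOf; split_ifs
    exacts [hsup2 i B, hsup1 i B]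
  have price_congr (i : Fin (n + 1)) : ∀ c c' : Fin n → Bool,
      (∀ l : Fin n, l.castSucc < i → c l = c' l) → p (sOf f1 f2 c) i = p (sOf f1 f2 c') i := by
    induction i using Fin.induction with
    | zero => exact fun c c' _ => funext fun l => by rw [hp0, hp0]
    | succ i ih =>
      intro c c' h
      have hs : sOf f1 f2 c i = sOf f1 f2 c' i := by
        simp only [sOf, h i Fin.castSucc_lt_succ]
      funext l
      rw [hupd, hupd, hs, ih c c' fun l hl => h l (hl.trans Fin.castSucc_lt_succ)]
  let b (i : Fin n) (c : Fin n → Bool) (x : Bool) : ℝ :=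
    let v := if x then f1 i else f2 i
    asup v (d (p (sOf f1 f2 c) i.castSucc) v) j
  have key := sum_max_selected_le b (fun i c c' h => by
    simp only [b, price_congr i.castSucc c c' fun l hl => h l (Fin.castSucc_lt_castSucc_iff.1 hl)])
    le_rfl
  simp only [zero_add, max_eq_right (maxZero_nonneg _), ← Finset.mul_sum] at key
  have price_le (c : Fin n → Bool) (i : Fin (n + 1)) :
      p (sOf f1 f2 c) i j ≤ 2 * maxZero fun i => b i c (c i) := by
    induction i using Fin.induction with
    | zero => rw [hp0]; exact mul_nonneg two_pos.le (maxZero_nonneg _)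
    | succ i ih =>
      rw [hupd]
      split_ifs
      · exact (pow2ceil_le ((sup_s c i _).1 j)).trans
          (mul_le_mul_of_nonneg_left (le_maxZero (fun i => b i c (c i)) i) two_pos.le)
      · exact ih
  have le_bid (c : Fin n → Bool) : (maxZero fun i => b i c (!c i)) ≤
      ⨆ i : {i : Fin n // j ∈ Bset d p f1 f2 c i},
        asup (rOf f1 f2 c i.1) (Bset d p f1 f2 c i.1) j := by
    have nonneg := Real.iSup_nonneg fun i : {i : Fin n // j ∈ Bset d p f1 f2 c i} =>
      (sup_r c i.1 (Bset d p f1 f2 c i.1)).1 j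
    refine maxZero_le nonneg fun i => ?_
    have hbi : b i c (!c i) = asup (rOf f1 f2 c i) (Bset d p f1 f2 c i) j := by
      simp only [b, Bset, rOf]
      cases c i <;> rfl
    rw [hbi]
    by_cases hi : j ∈ Bset d p f1 f2 c i
    · exact le_ciSup (f := fun i : {i : Fin n // j ∈ Bset d p f1 f2 c i} =>
        asup (rOf f1 f2 c i.1) (Bset d p f1 f2 c i.1) j) (Set.finite_range _).bddAbove ⟨i, hi⟩
    · rw [(sup_r c i _).2.1 j hi]
      exact nonneg
  have hP := Finset.sum_le_sum fun c (_ : c ∈ Finset.univ) => price_le c (Fin.last n)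
  have hR := Finset.sum_le_sum fun c (_ : c ∈ Finset.univ) => le_bid c
  rw [← Finset.mul_sum] at hP
  rw [ge_iff_le, mul_left_comm]
  exact mul_le_mul_of_nonneg_left (by linarith) (by positivity)
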